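/- arXiv:2409.16971 — 2 statements merged into one kernel-verified Lean document; each statement's English description precedes it below -/
import Mathlib

section
/- Let each f_i : ℝ^d → ℝ (i = 1,…,n) be convex and L-smooth, let h : ℝ^d → ℝ ∪ {+∞} be proper, lower semicontinuous and convex, set F(x) = (1/n)·Σ_{i=1}^n f_i(x) + h(x), and let x* be a minimizer of F with F* = F(x*). Then for every x ∈ ℝ^d, (1/n)·Σ_{i=1}^n ‖∇f_i(x) − ∇f_i(x*)‖² ≤ 2L·(F(x) − F*). -/
set_option autoImplicit false

open scoped RealInnerProductSpace

section aux
variable {E : Type*} [NormedAddCommGroup E] [InnerProductSpace ℝ E] [CompleteSpace E]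

lemma line_deriv (f : E → ℝ) (f' : E → E) (hg : ∀ x, HasGradientAt f (f' x) x) (x v : E) (t : ℝ) :
    HasDerivAt (fun s : ℝ => f (x + s • v)) ⟪f' (x + t • v), v⟫ t := by
  have h1 : HasDerivAt (fun s : ℝ => x + s • v) v t := by
    simpa using ((hasDerivAt_id t).smul_const v).const_add x
  have h2 := (hg (x + t • v)).hasFDerivAt.comp_hasDerivAt t h1
  have e : (InnerProductSpace.toDual ℝ E (f' (x + t • v))) v = ⟪f' (x + t • v), v⟫ := by simp
  rw [e] at h2
  exact h2

lemma descent (f : E → ℝ) (f' : E → E) (L : ℝ) (hg : ∀ x, HasGradientAt f (f' x) x)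
    (hs : ∀ x y, ‖f' x - f' y‖ ≤ L * ‖x - y‖) (x v : E) :
    f (x + v) ≤ f x + ⟪f' x, v⟫ + L / 2 * ‖v‖ ^ 2 := by
  have hd : ∀ t : ℝ, HasDerivAt (fun s : ℝ => f (x + s • v) - s * ⟪f' x, v⟫ - s ^ 2 * (L / 2 * ‖v‖ ^ 2))
      (⟪f' (x + t • v), v⟫ - ⟪f' x, v⟫ - 2 * t * (L / 2 * ‖v‖ ^ 2)) t := by
    intro t
    have h1 := line_deriv f f' hg x v t
    have h2 := (hasDerivAt_id t).mul_const ⟪f' x, v⟫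
    have h3 := ((hasDerivAt_id t).pow 2).mul_const (L / 2 * ‖v‖ ^ 2)
    refine ((h1.sub h2).sub h3).congr_deriv ?_
    simp
  have ha := antitoneOn_of_deriv_nonpos (convex_Icc (0:ℝ) 1)
    (fun t _ => (hd t).continuousAt.continuousWithinAt)
    (fun t _ => (hd t).differentiableAt.differentiableWithinAt) (by
      intro t ht
      rw [interior_Icc] at ht
      rw [(hd t).deriv]
      have h1 : ⟪f' (x + t • v) - f' x, v⟫ ≤ ‖f' (x + t • v) - f' x‖ * ‖v‖ := real_inner_le_norm _ _
      have h2 := hs (x + t • v) x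
      rw [add_sub_cancel_left, norm_smul, Real.norm_eq_abs, abs_of_pos ht.1] at h2
      rw [inner_sub_left] at h1
      nlinarith [mul_le_mul_of_nonneg_right h2 (norm_nonneg v)])
  have := ha (Set.left_mem_Icc.2 zero_le_one) (Set.right_mem_Icc.2 zero_le_one) zero_le_one
  simp at this
  linarith

lemma grad_ineq (f : E → ℝ) (f' : E → E) (hg : ∀ x, HasGradientAt f (f' x) x)
    (hc : ConvexOn ℝ Set.univ f) (x v : E) : f x + ⟪f' x, v⟫ ≤ f (x + v) := by
  have hc1 : ConvexOn ℝ Set.univ (fun s : ℝ => f (x + s • v)) := by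
    refine ⟨convex_univ, ?_⟩
    intro a _ b _ p q hp hq hpq
    have := hc.2 (Set.mem_univ (x + a • v)) (Set.mem_univ (x + b • v)) hp hq hpq
    convert this using 2
    have hq' : q = 1 - p := by linarith
    subst hq'
    simp only [smul_eq_mul]
    module
  have h := hc1.le_slope_of_hasDerivAt (Set.mem_univ (0:ℝ)) (Set.mem_univ (1:ℝ)) zero_lt_one
    (line_deriv f f' hg x v 0)
  simp [slope_def_field] at h
  linarith

lemma coco (f : E → ℝ) (f' : E → E) (L : ℝ) (hL : 0 < L) (hg : ∀ x, HasGradientAt f (f' x) x)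
    (hs : ∀ x y, ‖f' x - f' y‖ ≤ L * ‖x - y‖) (hc : ConvexOn ℝ Set.univ f) (x y : E) :
    ‖f' x - f' y‖ ^ 2 ≤ 2 * L * (f x - f y - ⟪f' y, x - y⟫) := by
  set w := f' x - f' y with hw
  have h1 := descent f f' L hg hs x (-(1 / L) • w)
  have h2 := grad_ineq f f' hg hc y (x + (-(1 / L) • w) - y)
  have e : y + (x + (-(1 / L) • w) - y) = x + (-(1 / L) • w) := by abel
  have e2 : x + (-(1 / L) • w) - y = (x - y) + (-(1 / L) • w) := by abel
  rw [e, e2, inner_add_right, inner_smul_right] at h2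
  rw [inner_smul_right, norm_smul, mul_pow, Real.norm_eq_abs, sq_abs] at h1
  have h3 : ⟪f' x, w⟫ - ⟪f' y, w⟫ = ‖w‖ ^ 2 := by
    rw [← inner_sub_left, ← hw, real_inner_self_eq_norm_sq]
  have h4 : L / 2 * ((-(1 / L)) ^ 2 * ‖w‖ ^ 2) = 1 / L * ‖w‖ ^ 2 / 2 := by field_simp
  have h5 : 1 / L * ‖w‖ ^ 2 / 2 ≤ f x - f y - ⟪f' y, x - y⟫ := by
    have h6 : 1 / L * ⟪f' x, w⟫ - 1 / L * ⟪f' y, w⟫ = 1 / L * ‖w‖ ^ 2 := by rw [← mul_sub, h3]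
    linarith
  have h7 : ‖w‖ ^ 2 = 2 * L * (1 / L * ‖w‖ ^ 2 / 2) := by field_simp
  rw [h7]
  exact mul_le_mul_of_nonneg_left h5 (by positivity)

end aux

/-- Lemma 2.1 / Lemma 1 of Xiao–Zhang.
If each `f i` is convex and `L`-smooth, `h` is proper, lower semicontinuous and convex
(with values in `ℝ ∪ {+∞}`, modelled by `EReal`), `F x = (1/n) ∑ i, f i x + h x`, and
`x*` minimizes `F`, then for every `x`,
`(1/n) ∑ i, ‖∇f i x − ∇f i x*‖² ≤ 2L (F x − F x*)`. -/
theorem stmt0 {d n : ℕ} (hn : 0 < n) {L : ℝ} (hL : 0 < L)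
    (f : Fin n → EuclideanSpace ℝ (Fin d) → ℝ)
    (f' : Fin n → EuclideanSpace ℝ (Fin d) → EuclideanSpace ℝ (Fin d))
    (hconv : ∀ i, ConvexOn ℝ Set.univ (f i))
    (hgrad : ∀ i x, HasGradientAt (f i) (f' i x) x)
    (hsmooth : ∀ i x y, ‖f' i x - f' i y‖ ≤ L * ‖x - y‖)
    (h : EuclideanSpace ℝ (Fin d) → EReal)
    (hh_proper : ∃ z, h z ≠ ⊤) (hh_ne_bot : ∀ z, h z ≠ ⊥)
    (hh_lsc : LowerSemicontinuous h)
    (hh_convex : ∀ x y : EuclideanSpace ℝ (Fin d), ∀ t : ℝ, 0 ≤ t → t ≤ 1 →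
      h (t • x + (1 - t) • y) ≤ (t : EReal) * h x + ((1 - t : ℝ) : EReal) * h y)
    (F : EuclideanSpace ℝ (Fin d) → EReal)
    (hF : ∀ x, F x = (((1 / (n : ℝ)) * ∑ i, f i x : ℝ) : EReal) + h x)
    (xstar : EuclideanSpace ℝ (Fin d))
    (hmin : ∀ z, F xstar ≤ F z) :
    ∀ x : EuclideanSpace ℝ (Fin d),
      (((1 / (n : ℝ)) * ∑ i, ‖f' i x - f' i xstar‖ ^ 2 : ℝ) : EReal) ≤
        ((2 * L : ℝ) : EReal) * (F x - F xstar) := by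
  intro x
  have hnR : (0:ℝ) < n := by exact_mod_cast hn
  have hstar_ne : h xstar ≠ ⊤ := by
    intro ht
    obtain ⟨z, hz⟩ := hh_proper
    have := hmin z
    rw [hF, hF, ht, EReal.coe_add_top, top_le_iff] at this
    lift h z to ℝ using ⟨hz, hh_ne_bot z⟩ with c
    rw [← EReal.coe_add] at this
    exact EReal.coe_ne_top _ this
  obtain ⟨a, ha⟩ : ∃ a : ℝ, h xstar = a :=
    ⟨_, (EReal.coe_toReal hstar_ne (hh_ne_bot _)).symm⟩
  by_cases hx : h x = ⊤
  · rw [hF, hF, hx, ha, EReal.coe_add_top, ← EReal.coe_add, EReal.top_sub_coe,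
      EReal.coe_mul_top_of_pos (by positivity)]
    exact le_top
  obtain ⟨b, hb⟩ : ∃ b : ℝ, h x = b := ⟨_, (EReal.coe_toReal hx (hh_ne_bot _)).symm⟩
  set v := x - xstar with hv
  have key : ∀ t : ℝ, 0 < t → t ≤ 1 →
      0 ≤ (1 / (n:ℝ)) * ∑ i, ⟪f' i xstar, v⟫ + (b - a) + t * (L / 2 * ‖v‖ ^ 2) := by
    intro t ht0 ht1
    have h1 := hh_convex x xstar t ht0.le ht1
    have e : t • x + (1 - t) • xstar = xstar + t • v := by rw [hv]; module
    rw [e, ha, hb] at h1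
    have h2 := (hmin (xstar + t • v))
    rw [hF, hF, ha] at h2
    have h3 := h2.trans (add_le_add_right h1 _)
    norm_cast at h3
    have h4 : ∑ i, f i (xstar + t • v) ≤
        ∑ i, f i xstar + t * ∑ i, ⟪f' i xstar, v⟫ + n * (t ^ 2 * (L / 2 * ‖v‖ ^ 2)) := by
      calc _ ≤ ∑ i, (f i xstar + t * ⟪f' i xstar, v⟫ + t ^ 2 * (L / 2 * ‖v‖ ^ 2)) := by
            refine Finset.sum_le_sum fun i _ => ?_
            have := descent (f i) (f' i) L (hgrad i) (hsmooth i) xstar (t • v)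
            rw [inner_smul_right, norm_smul, mul_pow, Real.norm_eq_abs, sq_abs] at this
            linarith
        _ = _ := by simp [Finset.sum_add_distrib, Finset.mul_sum]
    have h5 := mul_le_mul_of_nonneg_left h4 (show 0 ≤ 1 / (n:ℝ) by positivity)
    have e5 : 1 / (n:ℝ) * (∑ i, f i xstar + t * ∑ i, ⟪f' i xstar, v⟫
        + n * (t ^ 2 * (L / 2 * ‖v‖ ^ 2))) = 1 / (n:ℝ) * ∑ i, f i xstar
        + t * (1 / (n:ℝ) * ∑ i, ⟪f' i xstar, v⟫) + t ^ 2 * (L / 2 * ‖v‖ ^ 2) := by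
      field_simp
    rw [e5] at h5
    refine nonneg_of_mul_nonneg_right (a := t) ?_ ht0
    nlinarith
  have opt : 0 ≤ (1 / (n:ℝ)) * ∑ i, ⟪f' i xstar, v⟫ + (b - a) := by
    by_contra! hs
    set s := (1 / (n:ℝ)) * ∑ i, ⟪f' i xstar, v⟫ + (b - a)
    set C := L / 2 * ‖v‖ ^ 2
    have hC : 0 ≤ C := by positivity
    have hp : 0 < -s / (C + 1) := div_pos (by linarith) (by linarith)
    have h1 := key (min 1 (-s / (C + 1))) (lt_min one_pos hp) (min_le_left _ _)
    have h2 := mul_le_mul_of_nonneg_right (min_le_right 1 (-s / (C + 1))) hC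
    have h3 : -s / (C + 1) * (C + 1) = -s := by field_simp
    nlinarith
  have hsum : ∑ i, ‖f' i x - f' i xstar‖ ^ 2 ≤
      2 * L * (∑ i, f i x - ∑ i, f i xstar - ∑ i, ⟪f' i xstar, v⟫) := by
    rw [← Finset.sum_sub_distrib, ← Finset.sum_sub_distrib, Finset.mul_sum]
    exact Finset.sum_le_sum fun i _ =>
      coco (f i) (f' i) L hL (hgrad i) (hsmooth i) (hconv i) x xstar
  rw [hF, hF, ha, hb, ← EReal.coe_add, ← EReal.coe_add, ← EReal.coe_sub, ← EReal.coe_mul,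
    EReal.coe_le_coe_iff]
  have h6 := mul_le_mul_of_nonneg_left hsum (show 0 ≤ 1 / (n:ℝ) by positivity)
  have h7 := mul_nonneg hL.le opt
  linarith
end

section
/- Let each f_i : ℝ^d → ℝ (i = 1,…,n) be μ-strongly convex and L-smooth, let h : ℝ^d → ℝ ∪ {+∞} be proper, lower semicontinuous and convex, set f = (1/n)·Σ_{i=1}^n f_i, F = f + h, and let x* be the minimizer of F with F* = F(x*). Let p ∈ (0,1), let 0 < η ≤ min{ 1/L, 2/(18L + 2μ) }, and define ρ = max{ 1 − ημ, 1 − p/5 }. Fix x, w ∈ ℝ^d, for each i set v_i = ∇f_i(x) − ∇f_i(w) + ∇f(w) and x⁺(i) = prox_{η,h}(x − η·v_i). Then (1/n)·Σ_{i=1}^n [ ‖x⁺(i) − x*‖² + 2η·(F(x⁺(i)) − F*) ] + (10L/p)·η²·[ (1−p)·(F(w) − F*) + p·(F(x) − F*) ] ≤ ρ·[ ‖x − x*‖² + (10L/p)·η²·(F(w) − F*) + 2η·(F(x) − F*) ]. -/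
set_option autoImplicit false

open scoped RealInnerProductSpace

set_option linter.unusedSectionVars false
section helpers
variable {E : Type*} [NormedAddCommGroup E] [InnerProductSpace ℝ E] [CompleteSpace E]

lemma aux_line {f : E → ℝ} {f' : E → E} (hg : ∀ x, HasGradientAt f (f' x) x) (x v : E) (t : ℝ) :
    HasDerivAt (fun s : ℝ => f (x + s • v)) ⟪f' (x + t • v), v⟫ t := by
  have h1 := (hg (x + t • v)).hasFDerivAt
  have h2 : HasDerivAt (fun s : ℝ => x + s • v) v t := by
    simpa using ((hasDerivAt_id t).smul_const v).const_add x
  exact (h1.comp_hasDerivAt t h2).congr_deriv (by simp)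

lemma aux_descent {f : E → ℝ} {f' : E → E} {L : ℝ} (hg : ∀ x, HasGradientAt f (f' x) x)
    (hs : ∀ x y, ‖f' x - f' y‖ ≤ L * ‖x - y‖) (x y : E) :
    f y ≤ f x + ⟪f' x, y - x⟫ + L / 2 * ‖y - x‖ ^ 2 := by
  set v := y - x with hv
  have hd : ∀ t : ℝ, HasDerivAt (fun s : ℝ => f (x + s • v) - s * ⟪f' x, v⟫ - L / 2 * ‖v‖ ^ 2 * s ^ 2)
      (⟪f' (x + t • v), v⟫ - ⟪f' x, v⟫ - L * ‖v‖ ^ 2 * t) t := by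
    intro t
    have h1 := ((aux_line hg x v t).sub ((hasDerivAt_id t).mul_const ⟪f' x, v⟫)).sub
      ((hasDerivAt_pow 2 t).const_mul (L / 2 * ‖v‖ ^ 2))
    refine h1.congr_deriv ?_
    push_cast; ring
  have hanti : AntitoneOn (fun s : ℝ => f (x + s • v) - s * ⟪f' x, v⟫ - L / 2 * ‖v‖ ^ 2 * s ^ 2)
      (Set.Icc 0 1) := by
    apply antitoneOn_of_deriv_nonpos (convex_Icc 0 1)
    · exact fun t _ => (hd t).continuousAt.continuousWithinAt
    · exact fun t _ => (hd t).differentiableAt.differentiableWithinAt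
    · intro t ht
      rw [interior_Icc] at ht
      rw [(hd t).deriv, ← inner_sub_left]
      have h1 := real_inner_le_norm (f' (x + t • v) - f' x) v
      have h2 := hs (x + t • v) x
      rw [add_sub_cancel_left, norm_smul, Real.norm_of_nonneg ht.1.le] at h2
      nlinarith [norm_nonneg v, mul_le_mul_of_nonneg_right h2 (norm_nonneg v)]
  have := hanti (Set.left_mem_Icc.2 zero_le_one) (Set.right_mem_Icc.2 zero_le_one) zero_le_one
  simp only [zero_smul, one_smul, add_zero] at this
  have e : x + v = y := by simp [hv]
  rw [e] at this
  linarith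

lemma aux_strong {f : E → ℝ} {f' : E → E} {μ : ℝ} (hg : ∀ x, HasGradientAt f (f' x) x)
    (hc : ConvexOn ℝ Set.univ (fun x => f x - μ / 2 * ‖x‖ ^ 2)) (x y : E) :
    f x + ⟪f' x, y - x⟫ + μ / 2 * ‖y - x‖ ^ 2 ≤ f y := by
  set v := y - x with hv
  have e : x + v = y := by simp [hv]
  have hn : ∀ s : ℝ, ‖x + s • v‖ ^ 2 = ‖x‖ ^ 2 + 2 * s * ⟪x, v⟫ + s ^ 2 * ‖v‖ ^ 2 := by
    intro s
    rw [norm_add_sq_real, inner_smul_right, norm_smul, mul_pow, Real.norm_eq_abs, sq_abs]; ring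
  have hc' : ConvexOn ℝ Set.univ (fun s : ℝ => f (x + s • v) - μ / 2 * ‖x + s • v‖ ^ 2) := by
    have := hc.comp_affineMap (AffineMap.lineMap (k := ℝ) x y)
    simp only [Set.preimage_univ] at this
    refine this.congr ?_
    intro s _
    simp [AffineMap.lineMap_apply, hv, add_comm]
  have hd : HasDerivAt (fun s : ℝ => f (x + s • v) - μ / 2 * ‖x + s • v‖ ^ 2)
      (⟪f' x, v⟫ - μ * ⟪x, v⟫) 0 := by
    simp only [hn]
    have h1 := (aux_line hg x v 0).sub (((((hasDerivAt_id (0:ℝ)).const_mul 2).mul_const ⟪x, v⟫).const_add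
      (‖x‖^2) |>.add ((hasDerivAt_pow 2 (0:ℝ)).mul_const (‖v‖^2))).const_mul (μ / 2))
    refine h1.congr_deriv ?_
    simp; ring
  have := hc'.le_slope_of_hasDerivAt (Set.mem_univ 0) (Set.mem_univ 1) zero_lt_one hd
  rw [slope_def_field] at this
  simp only [hn] at this
  simp only [zero_smul, one_smul, add_zero, e] at this
  linarith

lemma aux_coco {f : E → ℝ} {f' : E → E} {L : ℝ} (hL : 0 < L)
    (hd : ∀ x y, f y ≤ f x + ⟪f' x, y - x⟫ + L / 2 * ‖y - x‖ ^ 2)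
    (hc : ∀ x y, f x + ⟪f' x, y - x⟫ ≤ f y) (x y : E) :
    ‖f' x - f' y‖ ^ 2 ≤ 2 * L * (f x - f y - ⟪f' y, x - y⟫) := by
  set u := f' x - f' y with hu
  have h1 := hd x (x - L⁻¹ • u)
  have h2 := hc y (x - L⁻¹ • u)
  have e1 : x - L⁻¹ • u - x = -(L⁻¹ • u) := by abel
  have e2 : x - L⁻¹ • u - y = (x - y) - L⁻¹ • u := by abel
  rw [e1, norm_neg, norm_smul, inner_neg_right, inner_smul_right, mul_pow, Real.norm_eq_abs, sq_abs] at h1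
  rw [e2, inner_sub_right, inner_smul_right] at h2
  have h3 : ⟪f' x, u⟫ - ⟪f' y, u⟫ = ‖u‖ ^ 2 := by rw [← inner_sub_left, ← hu, real_inner_self_eq_norm_sq]
  have h4 : L⁻¹ * ‖u‖ ^ 2 ≤ 2 * (f x - f y - ⟪f' y, x - y⟫) := by
    have : L / 2 * (L⁻¹ ^ 2 * ‖u‖ ^ 2) = L⁻¹ * ‖u‖ ^ 2 / 2 := by field_simp
    rw [this] at h1
    have : L⁻¹ * ⟪f' x, u⟫ - L⁻¹ * ⟪f' y, u⟫ = L⁻¹ * ‖u‖ ^ 2 := by rw [← h3]; ring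
    linarith
  have h5 := mul_le_mul_of_nonneg_left h4 hL.le
  rw [← mul_assoc, mul_inv_cancel₀ hL.ne'] at h5
  linarith

lemma aux_subgrad {h : E → EReal} (hb : ∀ z, h z ≠ ⊥)
    (hcv : ∀ x y : E, ∀ t : ℝ, 0 ≤ t → t ≤ 1 →
      h (t • x + (1 - t) • y) ≤ (t : EReal) * h x + ((1 - t : ℝ) : EReal) * h y)
    {φ : E → ℝ} {z0 a : E} {C : ℝ}
    (hub : ∀ z, φ z ≤ φ z0 + ⟪a, z - z0⟫ + C * ‖z - z0‖ ^ 2)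
    (hmin : ∀ z, h z0 + (φ z0 : EReal) ≤ h z + (φ z : EReal))
    (h0 : h z0 ≠ ⊤) (z : E) (hz : h z ≠ ⊤) :
    (h z0).toReal - ⟪a, z - z0⟫ ≤ (h z).toReal := by
  have r0 := EReal.coe_toReal h0 (hb z0)
  have rz := EReal.coe_toReal hz (hb z)
  set α := (h z0).toReal
  set β := (h z).toReal
  have key : ∀ t : ℝ, 0 < t → t ≤ 1 → α - ⟪a, z - z0⟫ ≤ β + t * (C * ‖z - z0‖ ^ 2) := by
    intro t ht ht1
    have h1 := hcv z z0 t ht.le ht1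
    have h2 := hmin (t • z + (1 - t) • z0)
    have h3 := hub (t • z + (1 - t) • z0)
    have e : t • z + (1 - t) • z0 - z0 = t • (z - z0) := by module
    rw [e, inner_smul_right, norm_smul, mul_pow, Real.norm_eq_abs, sq_abs] at h3
    rw [← r0, ← rz] at h1
    have h4 := h2.trans (add_le_add_left h1 _)
    rw [← r0] at h4
    norm_cast at h4
    have : 0 ≤ t * (β + t * (C * ‖z - z0‖ ^ 2) - (α - ⟪a, z - z0⟫)) := by nlinarith
    have := nonneg_of_mul_nonneg_right this ht
    linarith
  have hl : Filter.Tendsto (fun t : ℝ => β + t * (C * ‖z - z0‖ ^ 2)) (nhdsWithin 0 (Set.Ioi 0))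
      (nhds (β + 0 * (C * ‖z - z0‖ ^ 2))) :=
    ((continuous_const.add (continuous_id.mul continuous_const)).tendsto (0:ℝ)).mono_left
      nhdsWithin_le_nhds
  rw [zero_mul, add_zero] at hl
  refine ge_of_tendsto hl ?_
  filter_upwards [Ioc_mem_nhdsGT (zero_lt_one' ℝ)] with t ht using key t ht.1 ht.2

/-- pairwise form of the covariance -/
lemma aux_pair {n : ℕ} (a b : Fin n → E) :
    ∑ i, ∑ j, ⟪a i - a j, b i - b j⟫ = 2 * n * ∑ i, ⟪a i, b i⟫ - 2 * ⟪∑ i, a i, ∑ i, b i⟫ := by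
  simp only [inner_sub_left, inner_sub_right, Finset.sum_sub_distrib, sum_inner, inner_sum]
  simp only [Finset.sum_const, Finset.card_univ, Fintype.card_fin, nsmul_eq_mul, ← Finset.mul_sum]
  rw [Finset.sum_comm (f := fun i j => ⟪a j, b i⟫)]
  ring

/-- the per-sample prox-gradient inequality -/
lemma aux_step {fb : E → ℝ} {g : E → E} {hr : E → ℝ} {μ L η : ℝ} (hη : 0 < η) (hηL : η * L ≤ 1)
    {x xs y v : E}
    (hS : fb x + ⟪g x, xs - x⟫ + μ / 2 * ‖xs - x‖ ^ 2 ≤ fb xs)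
    (hD : fb y ≤ fb x + ⟪g x, y - x⟫ + L / 2 * ‖y - x‖ ^ 2)
    (hsub : hr y - ⟪(1 / η) • (y - (x - η • v)), xs - y⟫ ≤ hr xs) :
    ‖y - xs‖ ^ 2 + 2 * η * (fb y + hr y - (fb xs + hr xs))
      ≤ (1 - η * μ) * ‖x - xs‖ ^ 2 - 2 * η * ⟪v - g x, y - xs⟫ := by
  have e1 : xs - x = (xs - y) + (y - x) := by abel
  have e2 : y - (x - η • v) = (y - x) + η • v := by abel
  have e3 : y - xs = -(xs - y) := by abel
  have e4 : x - xs = -((xs - y) + (y - x)) := by abel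
  rw [e2, inner_smul_left, inner_add_left, inner_smul_left] at hsub
  rw [e4, e3, norm_neg, norm_neg, inner_neg_right, inner_sub_left]
  rw [e1, inner_add_right] at hS
  have e5 := norm_add_sq_real (xs - y) (y - x)
  rw [real_inner_comm] at e5
  simp only [conj_trivial] at hsub
  generalize xs - y = a at *
  generalize y - x = b at *
  have h2 := mul_le_mul_of_nonneg_left hsub (by linarith : 0 ≤ 2 * η)
  have e6 : 2 * η * (hr y - 1 / η * (⟪b, a⟫ + η * ⟪v, a⟫)) = 2 * η * hr y - 2 * (⟪b, a⟫ + η * ⟪v, a⟫) := by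
    field_simp
  rw [e6] at h2
  have h3 := mul_le_mul_of_nonneg_left hS (by linarith : 0 ≤ 2 * η)
  have h4 := mul_le_mul_of_nonneg_left hD (by linarith : 0 ≤ 2 * η)
  have h5 : η * L * ‖b‖ ^ 2 ≤ 1 * ‖b‖ ^ 2 := mul_le_mul_of_nonneg_right hηL (sq_nonneg _)
  nlinarith

/-- prox is Lipschitz, in the weak form used -/
lemma aux_prox {hr : E → ℝ} {η : ℝ} (hη : 0 < η) {x y y' v v' : E}
    (h1 : hr y - ⟪(1 / η) • (y - (x - η • v)), y' - y⟫ ≤ hr y')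
    (h2 : hr y' - ⟪(1 / η) • (y' - (x - η • v')), y - y'⟫ ≤ hr y) :
    -⟪v - v', y - y'⟫ ≤ η * ‖v - v'‖ ^ 2 := by
  have e1 : y' - y = -(y - y') := by abel
  have h3 : ⟪(y - (x - η • v)) - (y' - (x - η • v')), y - y'⟫ ≤ 0 := by
    rw [e1, inner_neg_right, inner_smul_left] at h1
    rw [inner_smul_left] at h2
    simp only [conj_trivial] at h1 h2
    rw [inner_sub_left]
    have : 1 / η * (⟪y - (x - η • v), y - y'⟫ - ⟪y' - (x - η • v'), y - y'⟫) ≤ 0 := by linarith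
    exact nonpos_of_mul_nonpos_right this (by positivity)
  have e2 : (y - (x - η • v)) - (y' - (x - η • v')) = (y - y') + η • (v - v') := by module
  rw [e2, inner_add_left, inner_smul_left, real_inner_self_eq_norm_sq] at h3
  simp only [conj_trivial] at h3
  have h4 := abs_le.1 (abs_real_inner_le_norm (v - v') (y - y'))
  have h5 : ‖y - y'‖ ≤ η * ‖v - v'‖ := by
    by_contra hc
    push Not at hc
    have : 0 < ‖y - y'‖ := lt_of_le_of_lt (by positivity) hc
    nlinarith [h4.1]
  nlinarith [h4.1, norm_nonneg (v - v')]

lemma aux_noise {n : ℕ} (hn : 0 < n) {η : ℝ} (hη : 0 < η) (v u y : Fin n → E) (c xs : E)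
    (hvu : ∀ i, v i = u i + c)
    (hp : ∀ i j, -⟪v i - v j, y i - y j⟫ ≤ η * ‖v i - v j‖ ^ 2) (m : E)
    (hm : (n : ℝ) • m = ∑ i, v i) :
    -∑ i, ⟪v i - m, y i - xs⟫ ≤ η * ∑ i, ‖u i‖ ^ 2 := by
  have hn' : (0 : ℝ) < n := by exact_mod_cast hn
  have h0 : ∑ i, (v i - m) = 0 := by
    rw [Finset.sum_sub_distrib, ← hm]; simp [Nat.cast_smul_eq_nsmul]
  have h1 := aux_pair (fun i => v i - m) (fun i => y i - xs)
  have h2 := aux_pair u u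
  simp only [h0, inner_zero_left, real_inner_self_eq_norm_sq, sub_sub_sub_cancel_right] at h1 h2
  have h3 : -∑ i, ∑ j, ⟪v i - v j, y i - y j⟫ ≤ η * ∑ i, ∑ j, ‖u i - u j‖ ^ 2 := by
    rw [← Finset.sum_neg_distrib, Finset.mul_sum]
    refine Finset.sum_le_sum fun i _ => ?_
    rw [← Finset.sum_neg_distrib, Finset.mul_sum]
    refine Finset.sum_le_sum fun j _ => ?_
    have := hp i j
    have e : v i - v j = u i - u j := by rw [hvu, hvu]; abel
    rwa [e] at this ⊢
  rw [h1, h2] at h3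
  have h4 : η * (2 * n * ∑ i, ‖u i‖ ^ 2 - 2 * ‖∑ i, u i‖ ^ 2) ≤ η * (2 * n * ∑ i, ‖u i‖ ^ 2) :=
    mul_le_mul_of_nonneg_left (by nlinarith [sq_nonneg ‖∑ i, u i‖]) hη.le
  have h5 : (2 * (n : ℝ)) * (-∑ i, ⟪v i - m, y i - xs⟫) ≤ 2 * n * (η * ∑ i, ‖u i‖ ^ 2) := by linarith
  exact le_of_mul_le_mul_left h5 (by positivity)

lemma aux_coe_sum {n : ℕ} (a : Fin n → ℝ) :
    ((∑ i, a i : ℝ) : EReal) = ∑ i, ((a i : ℝ) : EReal) :=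
  map_sum (⟨⟨Real.toEReal, EReal.coe_zero⟩, EReal.coe_add⟩ : ℝ →+ EReal) a Finset.univ

end helpers

set_option maxHeartbeats 2000000

/-- one-step Lyapunov contraction of the proximal loopless-SVRG,
Theorem 4.2: with `v_i = ∇f_i(x) − ∇f_i(w) + ∇f(w)`,
`x⁺(i) = prox_{η,h}(x − η v_i)` and `ρ = max{1 − ημ, 1 − p/5}`,
`(1/n)∑_i [‖x⁺(i) − x*‖² + 2η(F(x⁺(i)) − F*)]
  + (10L/p)η²[(1−p)(F(w) − F*) + p(F(x) − F*)]
  ≤ ρ [‖x − x*‖² + (10L/p)η²(F(w) − F*) + 2η(F(x) − F*)]`. -/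
theorem stmt9 {d n : ℕ} (hn : 0 < n) {μ L : ℝ} (hμ : 0 < μ) (hL : 0 < L)
    (f : Fin n → EuclideanSpace ℝ (Fin d) → ℝ)
    (f' : Fin n → EuclideanSpace ℝ (Fin d) → EuclideanSpace ℝ (Fin d))
    (hstrong : ∀ i, ConvexOn ℝ Set.univ (fun x => f i x - μ / 2 * ‖x‖ ^ 2))
    (hgrad : ∀ i x, HasGradientAt (f i) (f' i x) x)
    (hsmooth : ∀ i x y, ‖f' i x - f' i y‖ ≤ L * ‖x - y‖)
    (g : EuclideanSpace ℝ (Fin d) → EuclideanSpace ℝ (Fin d))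
    (hgradf : ∀ x, HasGradientAt (fun y => (1 / (n : ℝ)) * ∑ i, f i y) (g x) x)
    (h : EuclideanSpace ℝ (Fin d) → EReal)
    (hh_proper : ∃ z, h z ≠ ⊤) (hh_ne_bot : ∀ z, h z ≠ ⊥)
    (hh_lsc : LowerSemicontinuous h)
    (hh_convex : ∀ x y : EuclideanSpace ℝ (Fin d), ∀ t : ℝ, 0 ≤ t → t ≤ 1 →
      h (t • x + (1 - t) • y) ≤ (t : EReal) * h x + ((1 - t : ℝ) : EReal) * h y)
    (F : EuclideanSpace ℝ (Fin d) → EReal)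
    (hF : ∀ x, F x = (((1 / (n : ℝ)) * ∑ i, f i x : ℝ) : EReal) + h x)
    (xstar : EuclideanSpace ℝ (Fin d))
    (hmin : ∀ z, F xstar ≤ F z)
    (p : ℝ) (hp : 0 < p) (hp1 : p < 1)
    (η : ℝ) (hη : 0 < η) (hηle : η ≤ min (1 / L) (2 / (18 * L + 2 * μ)))
    (ρ : ℝ) (hρ : ρ = max (1 - η * μ) (1 - p / 5))
    (x w : EuclideanSpace ℝ (Fin d))
    (v : Fin n → EuclideanSpace ℝ (Fin d))
    (hv : ∀ i, v i = f' i x - f' i w + g w)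
    (xp : Fin n → EuclideanSpace ℝ (Fin d))
    (hxp : ∀ i, IsMinOn (fun z => h z +
        (((1 / (2 * η)) * ‖z - (x - η • v i)‖ ^ 2 : ℝ) : EReal)) Set.univ (xp i)) :
    ((1 / (n : ℝ) : ℝ) : EReal) * (∑ i,
        (((‖xp i - xstar‖ ^ 2 : ℝ) : EReal)
          + ((2 * η : ℝ) : EReal) * (F (xp i) - F xstar)))
      + ((10 * L / p * η ^ 2 : ℝ) : EReal) *
          (((1 - p : ℝ) : EReal) * (F w - F xstar) + ((p : ℝ) : EReal) * (F x - F xstar)) ≤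
    ((ρ : ℝ) : EReal) *
      (((‖x - xstar‖ ^ 2 : ℝ) : EReal)
        + ((10 * L / p * η ^ 2 : ℝ) : EReal) * (F w - F xstar)
        + ((2 * η : ℝ) : EReal) * (F x - F xstar)) := by
  have hn' : (0 : ℝ) < n := by exact_mod_cast hn
  have hηL : η * L ≤ 1 := by
    have := hηle.trans (min_le_left _ _)
    rwa [le_div_iff₀ hL] at this
  have hη2 : η * (18 * L + 2 * μ) ≤ 2 := by
    have := hηle.trans (min_le_right _ _)
    rwa [le_div_iff₀ (by positivity)] at this
  have hρ1 : 1 - η * μ ≤ ρ := hρ ▸ le_max_left _ _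
  have hρ2 : 1 - p / 5 ≤ ρ := hρ ▸ le_max_right _ _
  have hρ0 : 0 < ρ := by linarith
  obtain ⟨z0, hz0⟩ := hh_proper
  have hxs : h xstar ≠ ⊤ := by
    intro hc
    have := hmin z0
    rw [hF, hF, hc, EReal.coe_add_top, top_le_iff] at this
    rw [← EReal.coe_toReal hz0 (hh_ne_bot z0), ← EReal.coe_add] at this
    exact EReal.coe_ne_top _ this
  have hxpt : ∀ i, h (xp i) ≠ ⊤ := by
    intro i hc
    have := isMinOn_iff.1 (hxp i) z0 (Set.mem_univ _)
    rw [hc, EReal.top_add_coe, top_le_iff] at this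
    rw [← EReal.coe_toReal hz0 (hh_ne_bot z0), ← EReal.coe_add] at this
    exact EReal.coe_ne_top _ this
  set fb : EuclideanSpace ℝ (Fin d) → ℝ := fun y => (1 / (n : ℝ)) * ∑ i, f i y with hfb
  have hFr : ∀ z, h z ≠ ⊤ → F z = ((fb z + (h z).toReal : ℝ) : EReal) := by
    intro z hz
    rw [hF, EReal.coe_add, EReal.coe_toReal hz (hh_ne_bot z)]
  have hFt : ∀ z, h z = ⊤ → F z - F xstar = ⊤ := by
    intro z hz
    rw [hFr xstar hxs, hF, hz, EReal.coe_add_top, EReal.top_sub_coe]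
  have hk : 0 < 10 * L / p * η ^ 2 := by positivity
  by_cases hxt : h x = ⊤
  · have : ((‖x - xstar‖ ^ 2 : ℝ) : EReal) + ((10 * L / p * η ^ 2 : ℝ) : EReal) * (F w - F xstar) ≠ ⊥ := by
      by_cases hwt : h w = ⊤
      · rw [hFt w hwt, EReal.coe_mul_top_of_pos hk, EReal.coe_add_top]; simp
      · rw [hFr w hwt, hFr xstar hxs, ← EReal.coe_sub, ← EReal.coe_mul, ← EReal.coe_add]
        exact EReal.coe_ne_bot _
    rw [hFt x hxt, EReal.coe_mul_top_of_pos (by positivity : 0 < 2 * η), EReal.add_top_of_ne_bot this,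
      EReal.coe_mul_top_of_pos hρ0]
    exact le_top
  by_cases hwt : h w = ⊤
  · rw [hFt w hwt, EReal.coe_mul_top_of_pos hk, EReal.coe_add_top, hFr x hxt, hFr xstar hxs,
      ← EReal.coe_sub, ← EReal.coe_mul (2 * η), EReal.top_add_coe, EReal.coe_mul_top_of_pos hρ0]
    exact le_top
  -- everything is finite
  set hr : EuclideanSpace ℝ (Fin d) → ℝ := fun z => (h z).toReal with hhr
  have hsum : (∑ i, (((‖xp i - xstar‖ ^ 2 : ℝ) : EReal)
          + ((2 * η : ℝ) : EReal) * (F (xp i) - F xstar)))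
      = ((∑ i, (‖xp i - xstar‖ ^ 2 + 2 * η * (fb (xp i) + hr (xp i) - (fb xstar + hr xstar))) : ℝ) : EReal) := by
    rw [aux_coe_sum]
    refine Finset.sum_congr rfl fun i _ => ?_
    rw [hFr _ (hxpt i), hFr _ hxs, ← EReal.coe_sub, ← EReal.coe_mul, ← EReal.coe_add]
  rw [hsum, hFr x hxt, hFr w hwt, hFr xstar hxs]
  simp only [← EReal.coe_sub, ← EReal.coe_mul, ← EReal.coe_add]
  rw [EReal.coe_le_coe_iff]
  -- smoothness facts
  have hDi := fun i => aux_descent (hgrad i) (hsmooth i)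
  have hSi := fun i => aux_strong (hgrad i) (hstrong i)
  have hCi := fun i => aux_coco hL (hDi i)
    (fun a b => by nlinarith [hSi i a b, mul_nonneg hμ.le (sq_nonneg ‖b - a‖)])
  have hgi : ∀ a b, ⟪g a, b⟫ = (1 / (n : ℝ)) * ∑ i, ⟪f' i a, b⟫ := by
    intro a b
    have h1 := aux_line hgradf a b 0
    have h2 := (HasDerivAt.fun_sum (u := Finset.univ)
      (fun i _ => aux_line (hgrad i) a b 0)).const_mul (1 / (n : ℝ))
    simpa using h1.unique h2
  have hg : ∀ a, (n : ℝ) • g a = ∑ i, f' i a := by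
    intro a
    refine ext_inner_right ℝ fun b => ?_
    rw [inner_smul_left, sum_inner, hgi]
    simp only [conj_trivial]
    field_simp
  have havg : ∀ c : ℝ, (1 / (n : ℝ)) * ∑ _i : Fin n, c = c := by
    intro c; simp; field_simp
  have hDb : ∀ a b, fb b ≤ fb a + ⟪g a, b - a⟫ + L / 2 * ‖b - a‖ ^ 2 := by
    intro a b
    rw [hgi, ← havg (L / 2 * ‖b - a‖ ^ 2)]
    simp only [hfb]
    rw [← mul_add, ← mul_add, ← Finset.sum_add_distrib, ← Finset.sum_add_distrib]
    exact mul_le_mul_of_nonneg_left (Finset.sum_le_sum fun i _ => hDi i a b) (by positivity)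
  have hSb : ∀ a b, fb a + ⟪g a, b - a⟫ + μ / 2 * ‖b - a‖ ^ 2 ≤ fb b := by
    intro a b
    rw [hgi, ← havg (μ / 2 * ‖b - a‖ ^ 2)]
    simp only [hfb]
    rw [← mul_add, ← mul_add, ← Finset.sum_add_distrib, ← Finset.sum_add_distrib]
    exact mul_le_mul_of_nonneg_left (Finset.sum_le_sum fun i _ => hSi i a b) (by positivity)
  have hCb : ∀ a, ∑ i, ‖f' i a - f' i xstar‖ ^ 2
      ≤ n * (2 * L * (fb a - fb xstar - ⟪g xstar, a - xstar⟫)) := by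
    intro a
    refine (Finset.sum_le_sum fun i _ => hCi i a xstar).trans (le_of_eq ?_)
    rw [hgi, ← Finset.mul_sum, Finset.sum_sub_distrib, Finset.sum_sub_distrib]
    simp only [hfb]
    field_simp
  -- optimality of `xstar`
  have hopt : ∀ z, h z ≠ ⊤ → hr xstar - ⟪g xstar, z - xstar⟫ ≤ hr z := by
    intro z hz
    refine aux_subgrad hh_ne_bot hh_convex (hDb xstar) (fun y => ?_) hxs z hz
    have := hmin y
    rw [hF, hF, add_comm _ (h xstar), add_comm _ (h y)] at this
    exact this
  -- prox subgradients
  have hprox : ∀ i z, h z ≠ ⊤ →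
      hr (xp i) - ⟪(1 / η) • (xp i - (x - η • v i)), z - xp i⟫ ≤ hr z := by
    intro i z hz
    refine aux_subgrad hh_ne_bot hh_convex (C := 1 / (2 * η))
      (φ := fun z => (1 / (2 * η)) * ‖z - (x - η • v i)‖ ^ 2) (fun y => ?_)
      (fun y => isMinOn_iff.1 (hxp i) y (Set.mem_univ _)) (hxpt i) z hz
    have e : y - (x - η • v i) = (xp i - (x - η • v i)) + (y - xp i) := by abel
    rw [e, norm_add_sq_real, inner_smul_left]
    simp only [conj_trivial]
    refine le_of_eq ?_
    field_simp
  have hstep := fun i => aux_step (fb := fb) (g := g) (hr := hr) hη hηL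
    (hSb x xstar) (hDb x (xp i)) (hprox i xstar hxs)
  have hnoise := aux_noise hn hη v (fun i => f' i x - f' i w) xp (g w) xstar hv
    (fun i j => aux_prox hη (hprox i (xp j) (hxpt j)) (hprox j (xp i) (hxpt i))) (g x) (by
      simp only [hv, Finset.sum_add_distrib, Finset.sum_sub_distrib, ← hg]
      simp [Nat.cast_smul_eq_nsmul])
  have hvar : ∑ i, ‖f' i x - f' i w‖ ^ 2
      ≤ 2 * ∑ i, ‖f' i x - f' i xstar‖ ^ 2 + 2 * ∑ i, ‖f' i w - f' i xstar‖ ^ 2 := by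
    rw [Finset.mul_sum, Finset.mul_sum, ← Finset.sum_add_distrib]
    refine Finset.sum_le_sum fun i _ => ?_
    have e : f' i x - f' i w = (f' i x - f' i xstar) - (f' i w - f' i xstar) := by abel
    rw [e]
    have := parallelogram_law_with_norm ℝ (f' i x - f' i xstar) (f' i w - f' i xstar)
    nlinarith [mul_self_nonneg ‖(f' i x - f' i xstar) + (f' i w - f' i xstar)‖]
  have hox := hopt x hxt
  have how := hopt w hwt
  have hP0 : fb xstar + hr xstar ≤ fb x + hr x := by
    nlinarith [hSb xstar x, mul_nonneg hμ.le (sq_nonneg ‖x - xstar‖)]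
  have hQ0 : fb xstar + hr xstar ≤ fb w + hr w := by
    nlinarith [hSb xstar w, mul_nonneg hμ.le (sq_nonneg ‖w - xstar‖)]
  have hCx := hCb x
  have hCw := hCb w
  have htot := Finset.sum_le_sum (fun i (_ : i ∈ Finset.univ) => hstep i)
  rw [Finset.sum_sub_distrib, ← Finset.mul_sum (f := fun i => ⟪v i - g x, xp i - xstar⟫)] at htot
  change _ ≤ ρ * (‖x - xstar‖ ^ 2 + 10 * L / p * η ^ 2 * (fb w + hr w - (fb xstar + hr xstar))
    + 2 * η * (fb x + hr x - (fb xstar + hr xstar)))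
  change _ + 10 * L / p * η ^ 2 * ((1 - p) * (fb w + hr w - (fb xstar + hr xstar))
    + p * (fb x + hr x - (fb xstar + hr xstar))) ≤ _
  have hPle : fb x - fb xstar - ⟪g xstar, x - xstar⟫ ≤ fb x + hr x - (fb xstar + hr xstar) := by
    linarith
  have hQle : fb w - fb xstar - ⟪g xstar, w - xstar⟫ ≤ fb w + hr w - (fb xstar + hr xstar) := by
    linarith
  have hP0' := sub_nonneg.2 hP0
  have hQ0' := sub_nonneg.2 hQ0
  generalize fb x + hr x - (fb xstar + hr xstar) = P at *
  generalize fb w + hr w - (fb xstar + hr xstar) = Q at *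
  have hCx' : ∑ i, ‖f' i x - f' i xstar‖ ^ 2 ≤ n * (2 * L * P) :=
    hCx.trans (by gcongr)
  have hCw' : ∑ i, ‖f' i w - f' i xstar‖ ^ 2 ≤ n * (2 * L * Q) :=
    hCw.trans (by gcongr)
  have hU : ∑ i, ‖f' i x - f' i w‖ ^ 2 ≤ n * (4 * L * (P + Q)) := by linarith
  have hN := hnoise.trans (mul_le_mul_of_nonneg_left hU hη.le)
  have hN2 := mul_le_mul_of_nonneg_left hN (by positivity : 0 ≤ 2 * η)
  have hT : ∑ i, (‖xp i - xstar‖ ^ 2 + 2 * η * (fb (xp i) + hr (xp i) - (fb xstar + hr xstar)))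
      ≤ n * ((1 - η * μ) * ‖x - xstar‖ ^ 2 + 8 * L * η ^ 2 * (P + Q)) := by
    have e : ∑ _i : Fin n, (1 - η * μ) * ‖x - xstar‖ ^ 2 = n * ((1 - η * μ) * ‖x - xstar‖ ^ 2) := by
      simp
    rw [e] at htot
    nlinarith
  have hT2 := mul_le_mul_of_nonneg_left hT (by positivity : 0 ≤ 1 / (n : ℝ))
  rw [← mul_assoc, one_div_mul_cancel hn'.ne', one_mul] at hT2
  have e1 : 10 * L / p * η ^ 2 * ((1 - p) * Q + p * P)
      = 10 * L / p * η ^ 2 * (1 - p / 5) * Q - 8 * L * η ^ 2 * Q + 10 * L * η ^ 2 * P := by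
    field_simp; ring
  have g1 : (1 - η * μ) * ‖x - xstar‖ ^ 2 ≤ ρ * ‖x - xstar‖ ^ 2 :=
    mul_le_mul_of_nonneg_right hρ1 (sq_nonneg _)
  have g2 : (1 - p / 5) * (10 * L / p * η ^ 2 * Q) ≤ ρ * (10 * L / p * η ^ 2 * Q) :=
    mul_le_mul_of_nonneg_right hρ2 (mul_nonneg hk.le hQ0')
  have g3 : 9 * L * η * (2 * η * P) ≤ ρ * (2 * η * P) :=
    mul_le_mul_of_nonneg_right (by linarith) (by positivity)
  rw [e1]
  nlinarith
end
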